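/- arXiv:2401.13115 — 7 statements merged into one kernel-verified Lean document; each statement's English description precedes it below -/
import Mathlib

section
/- Let d ∈ ℕ, T ∈ ℝ, let p : ℝ × ℝ^d → ℝ be twice continuously differentiable in x, continuously differentiable in t, and everywhere positive, let b : ℝ × ℝ^d → ℝ^d be continuously differentiable in x, and let σ : ℝ → ℝ. Suppose p satisfies the Fokker–Planck equation ∂_t p(t,x) = (1/2) σ(t)² Δ_x p(t,x) − div_x( b(t,·) p(t,·) )(x) for all (t,x). Define p̄(t,x) := p(T−t, x) and b̄(t,x) := −b(T−t, x) + σ(T−t)² ∇_x log p(T−t, x). Then for all (t,x), ∂_t p̄(t,x) = (1/2) σ(T−t)² Δ_x p̄(t,x) − div_x( b̄(t,·) p̄(t,·) )(x). -/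
/-- Partial derivative of `f : ℝ^d → ℝ` in the `i`-th coordinate at `x`. -/
noncomputable def pderiv' {d : ℕ} (i : Fin d) (f : (Fin d → ℝ) → ℝ) (x : Fin d → ℝ) : ℝ :=
  deriv (fun y => f (Function.update x i y)) (x i)

/-- Laplacian in the spatial variable: sum of second partial derivatives. -/
noncomputable def laplacian' {d : ℕ} (f : (Fin d → ℝ) → ℝ) (x : Fin d → ℝ) : ℝ :=
  ∑ i, pderiv' i (fun y => pderiv' i f y) x

/-- Divergence of a vector field on ℝ^d: sum of partial derivatives of coordinates. -/
noncomputable def diverg' {d : ℕ} (V : (Fin d → ℝ) → (Fin d → ℝ)) (x : Fin d → ℝ) : ℝ :=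
  ∑ i, pderiv' i (fun y => V y i) x

theorem hasDerivAt_comp_update {d : ℕ} (i : Fin d) {f : (Fin d → ℝ) → ℝ} {x : Fin d → ℝ}
    (hf : DifferentiableAt ℝ f x) :
    HasDerivAt (fun y => f (Function.update x i y)) (fderiv ℝ f x (Pi.single i 1)) (x i) := by
  have hf' : HasFDerivAt f (fderiv ℝ f x) (Function.update x i (x i)) := by
    simpa using hf.hasFDerivAt
  exact hf'.comp_hasDerivAt (x i) (hasDerivAt_update x i (x i))

theorem pderiv'_eq_fderiv {d : ℕ} (i : Fin d) {f : (Fin d → ℝ) → ℝ} {x : Fin d → ℝ}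
    (hf : DifferentiableAt ℝ f x) : pderiv' i f x = fderiv ℝ f x (Pi.single i 1) :=
  (hasDerivAt_comp_update i hf).deriv

theorem contDiff_pderiv' {d : ℕ} (i : Fin d) {f : (Fin d → ℝ) → ℝ} (hf : ContDiff ℝ 2 f) :
    ContDiff ℝ 1 (fun y => pderiv' i f y) := by
  have h : (fun y => pderiv' i f y) = fun y => fderiv ℝ f y (Pi.single i 1) :=
    funext fun y => pderiv'_eq_fderiv i (hf.differentiable two_ne_zero y)
  rw [h]
  exact (hf.fderiv_right (by norm_num [one_add_one_eq_two])).clm_apply contDiff_const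

theorem pderiv'_log_mul {d : ℕ} (i : Fin d) {f : (Fin d → ℝ) → ℝ} {x : Fin d → ℝ}
    (hf : DifferentiableAt ℝ f x) (hx : f x ≠ 0) :
    pderiv' i (fun z => Real.log (f z)) x * f x = pderiv' i f x := by
  rw [pderiv'_eq_fderiv i (hf.log hx), pderiv'_eq_fderiv i hf, fderiv.log hf hx]
  simp only [smul_apply, smul_eq_mul]
  field_simp

theorem pderiv'_linear_combination {d : ℕ} (i : Fin d) {f g : (Fin d → ℝ) → ℝ}
    {x : Fin d → ℝ} (hf : DifferentiableAt ℝ f x) (hg : DifferentiableAt ℝ g x) (a c : ℝ) :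
    pderiv' i (fun y => a * f y + c * g y) x = a * pderiv' i f x + c * pderiv' i g x := by
  rw [pderiv'_eq_fderiv i hf, pderiv'_eq_fderiv i hg]
  exact (((hasDerivAt_comp_update i hf).const_mul a).add
    ((hasDerivAt_comp_update i hg).const_mul c)).deriv

/-- Time reversal of the Fokker–Planck equation: if `p` solves the Fokker–Planck
equation with drift `b` and diffusion coefficient `σ`, then `p̄(t,x) = p(T-t,x)`
solves the Fokker–Planck equation with diffusion coefficient `σ(T-t)` and drift
`b̄(t,x) = -b(T-t,x) + σ(T-t)² ∇ log p(T-t,x)`. -/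
theorem fokker_planck_time_reversal (d : ℕ) (T : ℝ)
    (p : ℝ → (Fin d → ℝ) → ℝ) (b : ℝ → (Fin d → ℝ) → (Fin d → ℝ)) (σ : ℝ → ℝ)
    (hp_x : ∀ t, ContDiff ℝ 2 (p t))
    (hp_t : ∀ x, ContDiff ℝ 1 (fun t => p t x))
    (hp_pos : ∀ t x, 0 < p t x)
    (hb : ∀ t, ContDiff ℝ 1 (b t))
    (hFP : ∀ t x, deriv (fun s => p s x) t
      = (1/2) * (σ t)^2 * laplacian' (p t) x
        - diverg' (fun y => fun i => b t y i * p t y) x) :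
    ∀ t x, deriv (fun s => p (T - s) x) t
      = (1/2) * (σ (T - t))^2 * laplacian' (p (T - t)) x
        - diverg' (fun y => fun i =>
            (-(b (T - t) y i)
              + (σ (T - t))^2 * pderiv' i (fun z => Real.log (p (T - t) z)) y)
            * p (T - t) y) x := by
  intro t x
  rw [deriv_comp_const_sub (f := fun s => p s x), hFP]
  have hp := hp_x (T - t)
  have hbp (i : Fin d) : Differentiable ℝ fun y => b (T - t) y i * p (T - t) y :=
    (((contDiff_pi.mp (hb (T - t))) i).differentiable one_ne_zero).mul
      (hp.differentiable two_ne_zero)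
  have hdp (i : Fin d) : Differentiable ℝ fun y => pderiv' i (p (T - t)) y :=
    (contDiff_pderiv' i hp).differentiable one_ne_zero
  have hcomp (i : Fin d) :
      pderiv' i (fun y => (-(b (T - t) y i)
          + (σ (T - t))^2 * pderiv' i (fun z => Real.log (p (T - t) z)) y) * p (T - t) y) x
        = -pderiv' i (fun y => b (T - t) y i * p (T - t) y) x
          + (σ (T - t))^2 * pderiv' i (fun y => pderiv' i (p (T - t)) y) x := by
    have hfun : (fun y => (-(b (T - t) y i)
          + (σ (T - t))^2 * pderiv' i (fun z => Real.log (p (T - t) z)) y) * p (T - t) y)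
        = fun y => (-1) * (b (T - t) y i * p (T - t) y)
          + (σ (T - t))^2 * pderiv' i (p (T - t)) y := by
      funext y
      rw [← pderiv'_log_mul i (hp.differentiable two_ne_zero y) (hp_pos (T - t) y).ne']
      ring
    rw [hfun, pderiv'_linear_combination i (hbp i x) (hdp i x)]
    ring
  simp only [diverg', laplacian', hcomp, Finset.sum_add_distrib, Finset.sum_neg_distrib,
    ← Finset.mul_sum]
  ring
end

section
/- Let d ∈ ℕ, let p₀ : ℝ^d → ℝ be a probability density, and let k : ℝ^d × ℝ^d → ℝ be such that for each x₀, the map x ↦ k(x, x₀) is a positive, continuously differentiable probability density. Define p(x) := ∫ p₀(x₀) k(x, x₀) dx₀ and assume p is positive and differentiable with ∇p(x) = ∫ p₀(x₀) ∇_x k(x, x₀) dx₀ for all x. Let s : ℝ^d → ℝ^d be measurable, and assume all of the following integrals are finite: ∫ p(x) |s(x)|² dx, ∫ p(x) |∇ log p(x)|² dx, ∫∫ p₀(x₀) k(x,x₀) |∇_x log k(x,x₀)|² dx dx₀, and ∫∫ p₀(x₀) |s(x)| |∇_x k(x,x₀)| dx dx₀. Define the explicit score matching objective J_ESM(s) :=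 ∫ p(x) |s(x) − ∇ log p(x)|² dx and the denoising score matching objective J_DSM(s) := ∫∫ p₀(x₀) k(x,x₀) |s(x) − ∇_x log k(x,x₀)|² dx dx₀. Then J_DSM(s) = J_ESM(s) + C, where C := ∫∫ p₀(x₀) k(x,x₀) |∇_x log k(x,x₀)|² dx dx₀ − ∫ p(x) |∇ log p(x)|² dx does not depend on s. -/
open MeasureTheory

open Filter Topology in
/-- Joint measurability of Carathéodory functions, up to null sets. -/
theorem aestronglyMeasurable_uncurry_of_continuous_left {X Ω β : Type*}
    [TopologicalSpace X] [TopologicalSpace.MetrizableSpace X] [SecondCountableTopology X]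
    [MeasurableSpace X] [OpensMeasurableSpace X] [MeasurableSpace Ω] [NormedAddCommGroup β]
    (μ : Measure X) [SFinite μ] {ν : Measure Ω} [SFinite ν] {u : X → Ω → β}
    (hcont : ∀ ω, Continuous fun x => u x ω) (hmeas : ∀ x, AEStronglyMeasurable (u x) ν) :
    AEStronglyMeasurable (Function.uncurry u) (μ.prod ν) := by
  obtain ⟨D, hDc, hDd⟩ := TopologicalSpace.exists_countable_dense X
  have hae : ∀ᵐ ω ∂ν, ∀ x ∈ D, u x ω = (hmeas x).mk (u x) ω :=
    (ae_ball_iff hDc).2 fun x _ => (hmeas x).ae_eq_mk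
  obtain ⟨S, hSae, hSm, hS⟩ := hae.exists_measurable_mem
  have hSD : ∀ x ∈ D, StronglyMeasurable (S.indicator (u x)) := by
    intro x hx
    have h : S.indicator (u x) = S.indicator ((hmeas x).mk (u x)) :=
      Set.indicator_congr fun ω hω => hS ω hω x hx
    rw [h]
    exact (hmeas x).stronglyMeasurable_mk.indicator hSm
  have hvcont : ∀ ω, Continuous fun x => S.indicator (u x) ω := by
    intro ω
    by_cases hω : ω ∈ S
    · simpa [hω] using hcont ω
    · simpa [hω] using continuous_const
  have hSall : ∀ x, StronglyMeasurable (S.indicator (u x)) := by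
    intro x
    obtain ⟨a, haD, ha⟩ := mem_closure_iff_seq_limit.1 (hDd x)
    exact stronglyMeasurable_of_tendsto atTop (fun n => hSD (a n) (haD n))
      (tendsto_pi_nhds.2 fun ω => ((hvcont ω).tendsto x).comp ha)
  have hjoint := stronglyMeasurable_uncurry_of_continuous_of_stronglyMeasurable
    (u := fun x => S.indicator (u x)) hvcont hSall
  refine ⟨_, hjoint, ?_⟩
  have hsnd : ∀ᵐ q ∂(μ.prod ν), q.2 ∈ S := Measure.quasiMeasurePreserving_snd.ae hSae
  filter_upwards [hsnd] with q hq
  simp [Function.uncurry, hq]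

open Filter Topology in
/-- The gradient in the first variable depends a.e.-measurably on a parameter. -/
theorem aestronglyMeasurable_gradient_param {d : ℕ} {Ω : Type*} [MeasurableSpace Ω]
    {ν : Measure Ω} {f : EuclideanSpace ℝ (Fin d) → Ω → ℝ}
    (hdiff : ∀ ω, Differentiable ℝ fun x => f x ω)
    (hmeas : ∀ x, AEStronglyMeasurable (f x) ν) (x : EuclideanSpace ℝ (Fin d)) :
    AEStronglyMeasurable (fun ω => gradient (fun y => f y ω) x) ν := by
  have hdir : ∀ v : EuclideanSpace ℝ (Fin d),
      AEStronglyMeasurable (fun ω => inner ℝ v (gradient (fun y => f y ω) x)) ν := by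
    intro v
    refine aestronglyMeasurable_of_tendsto_ae atTop
      (f := fun (n : ℕ) ω => (n : ℝ) • (f (x + (n : ℝ)⁻¹ • v) ω - f x ω))
      (fun n => ((hmeas _).sub (hmeas x)).const_smul (n : ℝ)) (Eventually.of_forall fun ω => ?_)
    have h := (hdiff ω x).hasGradientAt.hasFDerivAt.lim_real v
    have h' := h.comp (tendsto_natCast_atTop_atTop (R := ℝ))
    rw [real_inner_comm]
    simpa [Function.comp_def, InnerProductSpace.toDual_apply_apply] using h'
  let b := EuclideanSpace.basisFun (Fin d) ℝ
  have hsum : (fun ω => gradient (fun y => f y ω) x)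
      = fun ω => ∑ i, inner ℝ (b i) (gradient (fun y => f y ω) x) • b i :=
    funext fun ω => (b.sum_repr' _).symm
  rw [hsum]
  exact Finset.aestronglyMeasurable_fun_sum _ fun i _ => (hdir (b i)).smul_const (b i)

/-- Completing the square for a weighted score. -/
theorem mul_norm_sub_inv_smul_sq {E : Type*} [NormedAddCommGroup E] [InnerProductSpace ℝ E]
    {c : ℝ} (hc : c ≠ 0) (a g : E) :
    c * ‖a - c⁻¹ • g‖ ^ 2 = c * ‖a‖ ^ 2 - 2 * inner ℝ a g + c * ‖c⁻¹ • g‖ ^ 2 := by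
  rw [norm_sub_sq_real, real_inner_smul_right]
  field_simp

/-- Linearity of the integral for an expanded square. -/
theorem integral_sub_two_mul_add {α : Type*} [MeasurableSpace α] {μ : Measure α} {f g h : α → ℝ}
    (hf : Integrable f μ) (hg : Integrable g μ) (hh : Integrable h μ) :
    ∫ x, (f x - 2 * g x + h x) ∂μ = (∫ x, f x ∂μ) - 2 * (∫ x, g x ∂μ) + ∫ x, h x ∂μ := by
  rw [integral_add (f := fun x => f x - 2 * g x) (hf.sub (hg.const_mul 2)) hh,
    integral_sub hf (hg.const_mul 2), integral_const_mul]

/-- The denoising score matching objective equals the explicit score matching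
objective plus a constant independent of the candidate score `s`: for the mixture
density `p(x) = ∫ p₀(x₀) k(x,x₀) dx₀` (with score `∇ log p = ∇p / p`),
`J_DSM(s) = J_ESM(s) + C`, where
`C = ∫∫ p₀(x₀) k(x,x₀) |∇ₓ log k(x,x₀)|² dx dx₀ − ∫ p(x) |∇ log p(x)|² dx`. -/
theorem dsm_eq_esm_add_const (d : ℕ)
    (p₀ : EuclideanSpace ℝ (Fin d) → ℝ)
    (k : EuclideanSpace ℝ (Fin d) → EuclideanSpace ℝ (Fin d) → ℝ)
    (hp₀_nonneg : ∀ x₀, 0 ≤ p₀ x₀) (hp₀_int : ∫ x₀, p₀ x₀ = 1)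
    (hk_pos : ∀ x x₀, 0 < k x x₀)
    (hk_smooth : ∀ x₀, ContDiff ℝ 1 (fun x => k x x₀))
    (hk_int : ∀ x₀, ∫ x, k x x₀ = 1)
    (p : EuclideanSpace ℝ (Fin d) → ℝ)
    (hp_def : ∀ x, p x = ∫ x₀, p₀ x₀ * k x x₀)
    (hp_pos : ∀ x, 0 < p x)
    (hp_diff : Differentiable ℝ p)
    (hp_grad : ∀ x, gradient p x = ∫ x₀, p₀ x₀ • gradient (fun y => k y x₀) x)
    (s : EuclideanSpace ℝ (Fin d) → EuclideanSpace ℝ (Fin d)) (hs : Measurable s)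
    (hint1 : Integrable (fun x => p x * ‖s x‖^2))
    (hint2 : Integrable (fun x => p x * ‖(p x)⁻¹ • gradient p x‖^2))
    (hint3 : Integrable (fun q : EuclideanSpace ℝ (Fin d) × EuclideanSpace ℝ (Fin d) =>
        p₀ q.2 * (k q.1 q.2 * ‖(k q.1 q.2)⁻¹ • gradient (fun y => k y q.2) q.1‖^2)))
    (hint4 : Integrable (fun q : EuclideanSpace ℝ (Fin d) × EuclideanSpace ℝ (Fin d) =>
        p₀ q.2 * (‖s q.1‖ * ‖gradient (fun y => k y q.2) q.1‖))) :
    (∫ x₀, ∫ x, p₀ x₀ * (k x x₀ * ‖s x - (k x x₀)⁻¹ • gradient (fun y => k y x₀) x‖^2))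
      = (∫ x, p x * ‖s x - (p x)⁻¹ • gradient p x‖^2)
        + ((∫ x₀, ∫ x, p₀ x₀ * (k x x₀ * ‖(k x x₀)⁻¹ • gradient (fun y => k y x₀) x‖^2))
            - ∫ x, p x * ‖(p x)⁻¹ • gradient p x‖^2) := by
  have hpk : ∀ x, Integrable fun x₀ => p₀ x₀ * k x x₀ := fun x =>
    .of_integral_ne_zero (by rw [← hp_def]; exact (hp_pos x).ne')
  have hk_diff : ∀ x₀, Differentiable ℝ fun x => k x x₀ := fun x₀ =>
    (hk_smooth x₀).differentiable one_ne_zero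
  have hgrad_smul : ∀ x x₀, gradient (fun y => p₀ x₀ * k y x₀) x
      = p₀ x₀ • gradient (fun y => k y x₀) x := fun x x₀ => by
    simp [gradient, fderiv_const_mul (hk_diff x₀ x)]
  have hgrad_meas : ∀ x, AEStronglyMeasurable
      (fun x₀ => p₀ x₀ • gradient (fun y => k y x₀) x) volume := fun x => by
    simpa only [hgrad_smul] using aestronglyMeasurable_gradient_param
      (f := fun x x₀ => p₀ x₀ * k x x₀) (fun x₀ => (hk_diff x₀).const_mul _)
      (fun x => (hpk x).aestronglyMeasurable) x
  have hgrad_cont : ∀ x₀, Continuous fun x => p₀ x₀ • gradient (fun y => k y x₀) x := fun x₀ =>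
    ((InnerProductSpace.toDual ℝ _).symm.continuous.comp
      ((hk_smooth x₀).continuous_fderiv one_ne_zero)).const_smul (p₀ x₀)
  have hpk_meas : AEStronglyMeasurable
      (fun q : EuclideanSpace ℝ (Fin d) × EuclideanSpace ℝ (Fin d) => p₀ q.2 * k q.1 q.2)
      (volume.prod volume) :=
    aestronglyMeasurable_uncurry_of_continuous_left volume
      (u := fun x x₀ => p₀ x₀ * k x x₀)
      (fun x₀ => (hk_smooth x₀).continuous.const_mul _) fun x => (hpk x).aestronglyMeasurable
  have hgrad_joint : AEStronglyMeasurable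
      (fun q : EuclideanSpace ℝ (Fin d) × EuclideanSpace ℝ (Fin d) =>
        p₀ q.2 • gradient (fun y => k y q.2) q.1) (volume.prod volume) :=
    aestronglyMeasurable_uncurry_of_continuous_left volume
      (u := fun x x₀ => p₀ x₀ • gradient (fun y => k y x₀) x) hgrad_cont hgrad_meas
  have hs_joint : AEStronglyMeasurable
      (fun q : EuclideanSpace ℝ (Fin d) × EuclideanSpace ℝ (Fin d) => s q.1)
      (volume.prod volume) := (hs.comp measurable_fst).aestronglyMeasurable
  rw [Measure.volume_eq_prod] at hint3 hint4
  have hsq_int : Integrable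
      (fun q : EuclideanSpace ℝ (Fin d) × EuclideanSpace ℝ (Fin d) =>
        p₀ q.2 * k q.1 q.2 * ‖s q.1‖ ^ 2) (volume.prod volume) := by
    refine (integrable_prod_iff (hpk_meas.mul (hs_joint.norm.pow 2))).2
      ⟨.of_forall fun x => (hpk x).mul_const (‖s x‖ ^ 2), ?_⟩
    refine hint1.congr (.of_forall fun x => ?_)
    have hnorm : ∀ x₀, ‖p₀ x₀ * k x x₀ * ‖s x‖ ^ 2‖ = p₀ x₀ * k x x₀ * ‖s x‖ ^ 2 := fun x₀ =>
      Real.norm_of_nonneg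
        (mul_nonneg (mul_nonneg (hp₀_nonneg x₀) (hk_pos x x₀).le) (sq_nonneg _))
    simp only [Pi.mul_apply, Pi.pow_apply, hnorm, integral_mul_const, hp_def]
  have hcross_int : Integrable
      (fun q : EuclideanSpace ℝ (Fin d) × EuclideanSpace ℝ (Fin d) =>
        inner ℝ (s q.1) (p₀ q.2 • gradient (fun y => k y q.2) q.1)) (volume.prod volume) := by
    refine hint4.mono' (hs_joint.inner hgrad_joint) (.of_forall fun q => ?_)
    refine (norm_inner_le_norm _ _).trans_eq ?_
    rw [norm_smul, Real.norm_of_nonneg (hp₀_nonneg _)]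
    ring
  have hcross : ∀ᵐ x, ∫ x₀, inner ℝ (s x) (p₀ x₀ • gradient (fun y => k y x₀) x)
      = inner ℝ (s x) (gradient p x) := by
    filter_upwards [hint4.prod_right_ae] with x hx
    by_cases hsx : s x = 0
    · simp [hsx]
    · have hint : Integrable fun x₀ => p₀ x₀ • gradient (fun y => k y x₀) x := by
        refine (hx.mul_const ‖s x‖⁻¹).mono' (hgrad_meas x) (.of_forall fun x₀ => ?_)
        have : ‖s x‖ ≠ 0 := norm_ne_zero_iff.2 hsx
        rw [norm_smul, Real.norm_of_nonneg (hp₀_nonneg _)]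
        exact le_of_eq (by field_simp)
      rw [hp_grad]
      exact integral_inner hint (s x)
  have hscore_int : Integrable fun x => inner ℝ (s x) (gradient p x) :=
    hcross_int.integral_prod_left.congr hcross
  have hesm : (∫ x, p x * ‖s x - (p x)⁻¹ • gradient p x‖ ^ 2)
      = (∫ x, p x * ‖s x‖ ^ 2) - 2 * (∫ x, inner ℝ (s x) (gradient p x))
        + ∫ x, p x * ‖(p x)⁻¹ • gradient p x‖ ^ 2 := by
    simp_rw [mul_norm_sub_inv_smul_sq (hp_pos _).ne']
    exact integral_sub_two_mul_add hint1 hscore_int hint2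
  have hsq : (∫ q, p₀ q.2 * k q.1 q.2 * ‖s q.1‖ ^ 2 ∂(volume.prod volume))
      = ∫ x, p x * ‖s x‖ ^ 2 := by
    simp only [integral_prod _ hsq_int, integral_mul_const, hp_def]
  have hcross_prod : (∫ q, inner ℝ (s q.1) (p₀ q.2 • gradient (fun y => k y q.2) q.1)
      ∂(volume.prod volume)) = ∫ x, inner ℝ (s x) (gradient p x) := by
    rw [integral_prod _ hcross_int]
    exact integral_congr_ae hcross
  have hexpand : ∀ q : EuclideanSpace ℝ (Fin d) × EuclideanSpace ℝ (Fin d),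
      p₀ q.2 * (k q.1 q.2 * ‖s q.1 - (k q.1 q.2)⁻¹ • gradient (fun y => k y q.2) q.1‖ ^ 2)
        = p₀ q.2 * k q.1 q.2 * ‖s q.1‖ ^ 2
          - 2 * inner ℝ (s q.1) (p₀ q.2 • gradient (fun y => k y q.2) q.1)
          + p₀ q.2 * (k q.1 q.2 * ‖(k q.1 q.2)⁻¹ • gradient (fun y => k y q.2) q.1‖ ^ 2) :=
    fun q => by
      rw [mul_norm_sub_inv_smul_sq (hk_pos _ _).ne', real_inner_smul_right]
      ring
  have hdsm_int := ((hsq_int.sub (hcross_int.const_mul 2)).add hint3).congr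
    (.of_forall fun q => (hexpand q).symm)
  have hdsm := integral_prod_symm _ hdsm_int
  have hcond := integral_prod_symm _ hint3
  simp only at hdsm hcond
  rw [← hdsm, ← hcond, hesm, integral_congr_ae (.of_forall hexpand),
    integral_sub_two_mul_add hsq_int hcross_int hint3, hsq, hcross_prod]
  ring
end

section
/- Let d ∈ ℕ, let p₀ : ℝ^d → ℝ be a probability density, and let k : ℝ^d × ℝ^d → ℝ be such that for each x₀, the map x ↦ k(x, x₀) is a positive, continuously differentiable probability density. Define p(x) := ∫ p₀(x₀) k(x, x₀) dx₀ and assume p is positive and differentiable with ∇p(x) = ∫ p₀(x₀) ∇_x k(x, x₀) dx₀ for all x. Let s : ℝ^d → ℝ^d be measurable, and assume (x, x₀) ↦ p₀(x₀) |s(x)| |∇_x k(x, x₀)| is integrable on ℝ^d × ℝ^d. Then ∫ p(x) ⟨s(x), ∇ log p(x)⟩ dx = ∫∫ p₀(x₀) k(x, x₀) ⟨s(x), ∇_x log k(x, x₀)⟩ dx dx₀. -/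
open MeasureTheory
open scoped RealInnerProductSpace

open Filter Topology

/-- A family of functions `u x`, continuous in the parameter `x` and a.e. strongly measurable for
each fixed `x`, admits a jointly strongly measurable version off a null set of the second
variable. -/
theorem exists_stronglyMeasurable_uncurry_of_continuous {X Y β : Type*}
    [TopologicalSpace X] [TopologicalSpace.MetrizableSpace X] [MeasurableSpace X]
    [SecondCountableTopology X] [OpensMeasurableSpace X] [MeasurableSpace Y] {μ : Measure Y}
    [TopologicalSpace β] [TopologicalSpace.PseudoMetrizableSpace β] [Zero β] {u : X → Y → β}
    (hcont : ∀ y, Continuous fun x => u x y) (hmeas : ∀ x, AEStronglyMeasurable (u x) μ) :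
    ∃ u' : X → Y → β, StronglyMeasurable (Function.uncurry u') ∧ ∀ᵐ y ∂μ, ∀ x, u' x y = u x y := by
  obtain ⟨Q, hQ, hQd⟩ := TopologicalSpace.exists_countable_dense X
  have hmk : ∀ᵐ y ∂μ, ∀ q ∈ Q, u q y = (hmeas q).mk (u q) y :=
    (ae_ball_iff hQ).2 fun q _ => (hmeas q).ae_eq_mk
  obtain ⟨S, hS_sub, hS, hS_null⟩ := exists_measurable_superset_of_null hmk
  have hgood : ∀ y ∈ Sᶜ, ∀ q ∈ Q, u q y = (hmeas q).mk (u q) y := fun y hy => by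
    by_contra h
    exact hy (hS_sub h)
  refine ⟨fun x => Sᶜ.indicator (u x), ?_, ?_⟩
  · apply stronglyMeasurable_uncurry_of_continuous_of_stronglyMeasurable
    · intro y
      by_cases hy : y ∈ Sᶜ
      · simpa only [Set.indicator_of_mem hy] using hcont y
      · simpa only [Set.indicator_of_notMem hy] using continuous_const
    · intro x
      obtain ⟨q, hqQ, hq⟩ := mem_closure_iff_seq_limit.1 (hQd x)
      refine stronglyMeasurable_of_tendsto atTop
        (f := fun n => Sᶜ.indicator ((hmeas (q n)).mk (u (q n))))
        (fun n => (hmeas (q n)).stronglyMeasurable_mk.indicator hS.compl) ?_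
      rw [tendsto_pi_nhds]
      intro y
      by_cases hy : y ∈ Sᶜ
      · simp only [Set.indicator_of_mem hy]
        simp only [← hgood y hy _ (hqQ _)]
        exact ((hcont y).tendsto x).comp hq
      · simpa only [Set.indicator_of_notMem hy] using tendsto_const_nhds
  · filter_upwards [measure_eq_zero_iff_ae_notMem.1 hS_null] with y hy x
    exact Set.indicator_of_mem (s := Sᶜ) hy _

section Gradient

variable {E Y : Type*} [NormedAddCommGroup E] [InnerProductSpace ℝ E] [FiniteDimensional ℝ E]
  [MeasurableSpace Y] {μ : Measure Y} {c : Y → ℝ} {k : E → Y → ℝ}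

theorem aestronglyMeasurable_mul_inner_gradient
    (hk : ∀ y, Differentiable ℝ fun x => k x y)
    (hmeas : ∀ x, AEStronglyMeasurable (fun y => c y * k x y) μ) (x v : E) :
    AEStronglyMeasurable (fun y => c y * ⟪v, gradient (fun z => k z y) x⟫) μ := by
  refine aestronglyMeasurable_of_tendsto_ae atTop
    (f := fun (n : ℕ) y => (n : ℝ) * (c y * k (x + (n : ℝ)⁻¹ • v) y - c y * k x y))
    (fun n => ((hmeas _).sub (hmeas x)).const_mul _) (ae_of_all _ fun y => ?_)
  have h := (((hk y x).hasFDerivAt.lim_real v).comp tendsto_natCast_atTop_atTop).const_mul (c y)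
  rw [inner_gradient_right]
  refine h.congr fun n => ?_
  simp only [Function.comp_apply, smul_eq_mul]
  ring

theorem aestronglyMeasurable_smul_gradient
    (hk : ∀ y, Differentiable ℝ fun x => k x y)
    (hmeas : ∀ x, AEStronglyMeasurable (fun y => c y * k x y) μ) (x : E) :
    AEStronglyMeasurable (fun y => c y • gradient (fun z => k z y) x) μ := by
  let b := stdOrthonormalBasis ℝ E
  have h : (fun y => c y • gradient (fun z => k z y) x) =
      fun y => ∑ i, (c y * ⟪b i, gradient (fun z => k z y) x⟫) • b i := by
    funext y
    simp only [mul_smul, ← Finset.smul_sum, b.sum_repr']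
  rw [h]
  exact Finset.aestronglyMeasurable_fun_sum _ fun i _ =>
    (aestronglyMeasurable_mul_inner_gradient hk hmeas x (b i)).smul_const _

theorem aestronglyMeasurable_prod_mul_inner_gradient [MeasurableSpace E] [BorelSpace E] [SFinite μ]
    {ν : Measure E} (hk : ∀ y, ContDiff ℝ 1 fun x => k x y)
    (hmeas : ∀ x, AEStronglyMeasurable (fun y => c y * k x y) μ)
    {s : E → E} (hs : Measurable s) :
    AEStronglyMeasurable
      (fun q : E × Y => c q.2 * ⟪s q.1, gradient (fun z => k z q.2) q.1⟫) (ν.prod μ) := by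
  obtain ⟨u', hu', hu'_eq⟩ := exists_stronglyMeasurable_uncurry_of_continuous (μ := μ)
    (u := fun (w : E × E) y => c y * ⟪w.2, gradient (fun z => k z y) w.1⟫)
    (fun y => by
      have hf : Continuous (fderiv ℝ fun z => k z y) := (hk y).continuous_fderiv one_ne_zero
      simp only [inner_gradient_right]
      exact continuous_const.mul ((hf.comp continuous_fst).clm_apply continuous_snd))
    (fun w => aestronglyMeasurable_mul_inner_gradient
      (fun y => (hk y).differentiable one_ne_zero) hmeas w.1 w.2)
  have hg : Measurable fun q : E × Y => ((q.1, s q.1), q.2) := by fun_prop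
  refine ⟨_, hu'.comp_measurable hg, ?_⟩
  filter_upwards [Measure.quasiMeasurePreserving_snd.ae hu'_eq] with q hq
  exact (hq (q.1, s q.1)).symm

end Gradient

/-- The inner-product exchange identity of denoising score matching: for a mixture
density `p(x) = ∫ p₀(x₀) k(x,x₀) dx₀`, the `p`-expectation of `⟨s, ∇ log p⟩` equals
the double expectation of `⟨s, ∇ₓ log k(·,x₀)⟩`, where `∇ log p = ∇p / p`. -/
theorem dsm_inner_product_identity (d : ℕ)
    (p₀ : EuclideanSpace ℝ (Fin d) → ℝ)
    (k : EuclideanSpace ℝ (Fin d) → EuclideanSpace ℝ (Fin d) → ℝ)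
    (hp₀_nonneg : ∀ x₀, 0 ≤ p₀ x₀) (hp₀_int : ∫ x₀, p₀ x₀ = 1)
    (hk_pos : ∀ x x₀, 0 < k x x₀)
    (hk_smooth : ∀ x₀, ContDiff ℝ 1 (fun x => k x x₀))
    (hk_int : ∀ x₀, ∫ x, k x x₀ = 1)
    (p : EuclideanSpace ℝ (Fin d) → ℝ)
    (hp_def : ∀ x, p x = ∫ x₀, p₀ x₀ * k x x₀)
    (hp_pos : ∀ x, 0 < p x)
    (hp_diff : Differentiable ℝ p)
    (hp_grad : ∀ x, gradient p x = ∫ x₀, p₀ x₀ • gradient (fun y => k y x₀) x)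
    (s : EuclideanSpace ℝ (Fin d) → EuclideanSpace ℝ (Fin d)) (hs : Measurable s)
    (hint : Integrable (fun q : EuclideanSpace ℝ (Fin d) × EuclideanSpace ℝ (Fin d) =>
        p₀ q.2 * (‖s q.1‖ * ‖gradient (fun y => k y q.2) q.1‖))) :
    (∫ x, p x * ⟪s x, (p x)⁻¹ • gradient p x⟫)
      = ∫ x₀, ∫ x, p₀ x₀ * (k x x₀ * ⟪s x, (k x x₀)⁻¹ • gradient (fun y => k y x₀) x⟫) := by
  have hk_diff : ∀ x₀, Differentiable ℝ fun x => k x x₀ :=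
    fun x₀ => (hk_smooth x₀).differentiable one_ne_zero
  have hmeas : ∀ x, AEStronglyMeasurable (fun x₀ => p₀ x₀ * k x x₀) := fun x => by
    refine (Integrable.of_integral_ne_zero ?_).aestronglyMeasurable
    rw [← hp_def]
    exact (hp_pos x).ne'
  have hint_inner : Integrable (Function.uncurry fun x x₀ =>
      p₀ x₀ * ⟪s x, gradient (fun y => k y x₀) x⟫) := by
    refine hint.mono' (aestronglyMeasurable_prod_mul_inner_gradient hk_smooth hmeas hs)
      (ae_of_all _ fun q => ?_)
    rw [Function.uncurry, norm_mul, Real.norm_of_nonneg (hp₀_nonneg _)]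
    exact mul_le_mul_of_nonneg_left (norm_inner_le_norm _ _) (hp₀_nonneg _)
  have hinner : ∀ᵐ x, p x * ⟪s x, (p x)⁻¹ • gradient p x⟫ =
      ∫ x₀, p₀ x₀ * ⟪s x, gradient (fun y => k y x₀) x⟫ := by
    filter_upwards [hint.prod_right_ae] with x hx
    rw [real_inner_smul_right, mul_inv_cancel_left₀ (hp_pos x).ne', hp_grad]
    by_cases hsx : s x = 0
    · simp [hsx]
    have hgrad : Integrable fun x₀ => p₀ x₀ • gradient (fun y => k y x₀) x := by
      refine (hx.const_mul ‖s x‖⁻¹).mono'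
        (aestronglyMeasurable_smul_gradient hk_diff hmeas x) (ae_of_all _ fun x₀ => ?_)
      have hsx' : ‖s x‖ ≠ 0 := norm_ne_zero_iff.2 hsx
      rw [norm_smul, Real.norm_of_nonneg (hp₀_nonneg _), mul_left_comm (p₀ x₀),
        inv_mul_cancel_left₀ hsx']
    rw [← integral_inner hgrad]
    simp only [real_inner_smul_right]
  rw [integral_congr_ae hinner, integral_integral_swap hint_inner]
  simp only [real_inner_smul_right, mul_inv_cancel_left₀ (hk_pos _ _).ne']
end

section
/- Let T > 0, let 0 < β_min ≤ β_max, define the linear schedule β(s) := β_min + (s/T)(β_max − β_min) for s ∈ [0,T], and B(s) := ∫_0^s β(v) dv. Let κ > 0 and h > 0, and define u(t) := ∫_{T−t}^{T} β(s) ( −1 + 2h − 2κ / ( (1+κ) e^{B(s)} − κ ) ) ds for t ∈ [0,T]. Then u(T) ≤ −B(T) + 2 β_max h T − (2κ/(1+κ)) (1 − e^{−β_min T}). -/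
/-- Upper bound for the Grönwall exponent `u(T)` in the Wasserstein analysis of the
contractive VP diffusion model with linear schedule
`β(s) = β_min + (s/T)(β_max − β_min)` and `B(s) = ∫_0^s β(v) dv`:
`u(T) ≤ −B(T) + 2 β_max h T − (2κ/(1+κ))(1 − e^{−β_min T})`. -/
theorem cvp_exponent_bound (T : ℝ) (hT : 0 < T)
    (βmin βmax : ℝ) (hβmin : 0 < βmin) (hββ : βmin ≤ βmax)
    (β : ℝ → ℝ) (hβ : ∀ s, β s = βmin + (s / T) * (βmax - βmin))
    (B : ℝ → ℝ) (hB : ∀ s, B s = ∫ v in (0 : ℝ)..s, β v)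
    (κ h : ℝ) (hκ : 0 < κ) (hh : 0 < h)
    (u : ℝ → ℝ)
    (hu : ∀ t, u t = ∫ s in (T - t)..T,
        β s * (-1 + 2 * h - 2 * κ / ((1 + κ) * Real.exp (B s) - κ))) :
    u T ≤ -B T + 2 * βmax * h * T
      - (2 * κ / (1 + κ)) * (1 - Real.exp (-βmin * T)) := by
  have hβc : Continuous β := by
    rw [funext hβ]
    fun_prop
  have hBd : ∀ s, HasDerivAt B (β s) s := fun s => by
    rw [funext hB]
    exact (hβc.integral_hasStrictDerivAt 0 s).hasDerivAt
  have hBc : Continuous B := continuous_iff_continuousAt.2 fun s => (hBd s).continuousAt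
  have hB0 : B 0 = 0 := by simp [hB]
  have hβ_lower : ∀ s, 0 ≤ s → βmin ≤ β s := fun s hs => by
    rw [hβ]
    have : 0 ≤ s / T * (βmax - βmin) := mul_nonneg (by positivity) (by linarith)
    linarith
  have hβ_upper : ∀ s, s ≤ T → β s ≤ βmax := fun s hs => by
    rw [hβ]
    have : s / T * (βmax - βmin) ≤ 1 * (βmax - βmin) :=
      mul_le_mul_of_nonneg_right ((div_le_one hT).2 hs) (by linarith)
    linarith
  have hB_lower : ∀ s, 0 ≤ s → βmin * s ≤ B s := fun s hs => by
    have key : ∫ _ in (0 : ℝ)..s, βmin ≤ ∫ v in (0 : ℝ)..s, β v :=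
      intervalIntegral.integral_mono_on hs (by simp) (hβc.intervalIntegrable 0 s)
        fun x hx => hβ_lower x hx.1
    rw [hB]
    simpa [mul_comm] using key
  have hden : ∀ s, 0 ≤ s → 0 < (1 + κ) * Real.exp (B s) - κ := fun s hs => by
    have hBs : 0 ≤ B s := (mul_nonneg hβmin.le hs).trans (hB_lower s hs)
    have hexp : 1 ≤ Real.exp (B s) := Real.one_le_exp hBs
    nlinarith
  have hbound_cont : Continuous fun s =>
      -β s + 2 * βmax * h - 2 * κ / (1 + κ) * (Real.exp (-B s) * β s) := by fun_prop
  have hbound_integral : ∫ s in (0 : ℝ)..T,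
      (-β s + 2 * βmax * h - 2 * κ / (1 + κ) * (Real.exp (-B s) * β s)) =
      -B T + 2 * βmax * h * T - 2 * κ / (1 + κ) * (1 - Real.exp (-B T)) := by
    rw [intervalIntegral.integral_eq_sub_of_hasDerivAt
      (f := fun s => -B s + 2 * βmax * h * s + 2 * κ / (1 + κ) * Real.exp (-B s))
      (fun s _ => ?_) (hbound_cont.intervalIntegrable 0 T)]
    · simp only [hB0, neg_zero, Real.exp_zero]
      ring
    · refine (((hBd s).neg.add ((hasDerivAt_id s).const_mul (2 * βmax * h))).add
        ((hBd s).neg.exp.const_mul (2 * κ / (1 + κ)))).congr_deriv ?_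
      simp only [Pi.neg_apply]
      ring
  have hu_le : u T ≤ ∫ s in (0 : ℝ)..T,
      (-β s + 2 * βmax * h - 2 * κ / (1 + κ) * (Real.exp (-B s) * β s)) := by
    rw [hu, sub_self]
    refine intervalIntegral.integral_mono_on hT.le ?_ (hbound_cont.intervalIntegrable 0 T) ?_
    · refine ContinuousOn.intervalIntegrable_of_Icc hT.le ?_
      refine hβc.continuousOn.mul (continuousOn_const.sub (continuousOn_const.div ?_ ?_))
      · fun_prop
      · exact fun s hs => (hden s hs.1).ne'
    · intro s hs
      have hβs : 0 ≤ β s := hβmin.le.trans (hβ_lower s hs.1)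
      have hdiv : 2 * κ / (1 + κ) * Real.exp (-B s) ≤
          2 * κ / ((1 + κ) * Real.exp (B s) - κ) := by
        rw [Real.exp_neg, ← div_eq_mul_inv, div_div]
        exact div_le_div_of_nonneg_left (by positivity) (hden s hs.1) (by linarith)
      have hκ_term := mul_le_mul_of_nonneg_left hdiv hβs
      have hh_term := mul_le_mul_of_nonneg_left (hβ_upper s hs.2) hh.le
      linarith
  have hexp : Real.exp (-B T) ≤ Real.exp (-βmin * T) :=
    Real.exp_le_exp.2 (by linarith [hB_lower T hT.le])
  refine (hu_le.trans_eq hbound_integral).trans ?_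
  gcongr
end

section
/- Let d ∈ ℕ, and for v > 0 define the centered Gaussian density φ_v(y) := (2πv)^{−d/2} exp(−|y|²/(2v)) on ℝ^d. Let μ be a probability measure on ℝ^d, let T > 0 and 0 < σ_min < σ_max, and define σ_VE(s)² := σ_min² ( (σ_max/σ_min)^{2s/T} − 1 ) for s ≥ 0, with VE marginal density p_VE(s, x) := ∫ φ_{σ_VE(s)²}(x − x₀) dμ(x₀) for s > 0. Let f > 0 and g > 0, define the CsubVP-type marginal density p_C(x) := ∫ φ_{f² g²}(x − f x₀) dμ(x₀), and define τ := (T/2) · log(1 + g²/σ_min²) / log(σ_max/σ_min). Then τ > 0 and for every x ∈ ℝ^d, p_C(x) = f^{−d} · p_VE(τ, x/f). -/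
open MeasureTheory

/-- The centered Gaussian density `N(0, v I)` on ℝ^d. -/
noncomputable def gaussDensity (d : ℕ) (v : ℝ) (y : EuclideanSpace ℝ (Fin d)) : ℝ :=
  (2 * Real.pi * v) ^ (-(d : ℝ) / 2) * Real.exp (-‖y‖ ^ 2 / (2 * v))

/-- Scaling a centered Gaussian by `c` multiplies its variance by `c ^ 2`. -/
theorem gaussDensity_smul (d : ℕ) {c v : ℝ} (hc : 0 < c) (hv : 0 ≤ v)
    (y : EuclideanSpace ℝ (Fin d)) :
    gaussDensity d (c ^ 2 * v) (c • y) = c ^ (-(d : ℝ)) * gaussDensity d v y := by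
  have hpow : (c ^ 2) ^ (-(d : ℝ) / 2) = c ^ (-(d : ℝ)) := by
    rw [← Real.rpow_natCast, ← Real.rpow_mul hc.le]
    congr 1
    push_cast
    ring
  have hexp : -‖c • y‖ ^ 2 / (2 * (c ^ 2 * v)) = -‖y‖ ^ 2 / (2 * v) := by
    rw [norm_smul, mul_pow, Real.norm_eq_abs, sq_abs,
      ← mul_div_mul_left (-‖y‖ ^ 2) (2 * v) (pow_ne_zero 2 hc.ne')]
    ring_nf
  rw [gaussDensity, gaussDensity, hexp,
    show 2 * Real.pi * (c ^ 2 * v) = c ^ 2 * (2 * Real.pi * v) by ring,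
    Real.mul_rpow (by positivity) (by positivity), hpow, mul_assoc]

/-- The marginal density of a diffusion with Gaussian perturbation kernel
`N(f X₀, f² g² I)` (as for contractive subVP) is a space rescaling of the VE
marginal at the changed time `τ = (T/2) log(1 + g²/σ_min²) / log(σ_max/σ_min)`:
`p_C(x) = f^{−d} p_VE(τ, x/f)`, and `τ > 0`. -/
theorem csubvp_marginal_from_ve (d : ℕ)
    (μ : Measure (EuclideanSpace ℝ (Fin d))) [IsProbabilityMeasure μ]
    (T σmin σmax : ℝ) (hT : 0 < T) (hσmin : 0 < σmin) (hσ : σmin < σmax)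
    (σVE2 : ℝ → ℝ)
    (hσVE2 : ∀ s, σVE2 s = σmin ^ 2 * ((σmax / σmin) ^ (2 * s / T) - 1))
    (pVE : ℝ → EuclideanSpace ℝ (Fin d) → ℝ)
    (hpVE : ∀ s x, pVE s x = ∫ x₀, gaussDensity d (σVE2 s) (x - x₀) ∂μ)
    (f g : ℝ) (hf : 0 < f) (hg : 0 < g)
    (pC : EuclideanSpace ℝ (Fin d) → ℝ)
    (hpC : ∀ x, pC x = ∫ x₀, gaussDensity d (f ^ 2 * g ^ 2) (x - f • x₀) ∂μ)
    (τ : ℝ)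
    (hτ : τ = (T / 2) * Real.log (1 + g ^ 2 / σmin ^ 2) / Real.log (σmax / σmin)) :
    0 < τ ∧ ∀ x, pC x = f ^ (-(d : ℝ)) * pVE τ (f⁻¹ • x) := by
  have hr : 1 < σmax / σmin := (one_lt_div hσmin).2 hσ
  have hr0 : 0 < σmax / σmin := zero_lt_one.trans hr
  have hlog : 0 < Real.log (σmax / σmin) := Real.log_pos hr
  have hq : 0 < g ^ 2 / σmin ^ 2 := by positivity
  have hlogq : 0 < Real.log (1 + g ^ 2 / σmin ^ 2) := Real.log_pos (by linarith)
  have hvar : σVE2 τ = g ^ 2 := by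
    have harg : Real.log (σmax / σmin) * (2 * τ / T) = Real.log (1 + g ^ 2 / σmin ^ 2) := by
      rw [hτ]
      field_simp
    rw [hσVE2, Real.rpow_def_of_pos hr0, harg, Real.exp_log (by linarith)]
    field_simp
    ring
  refine ⟨by rw [hτ]; positivity, fun x => ?_⟩
  rw [hpC, hpVE, hvar, ← integral_const_mul]
  refine integral_congr_ae (.of_forall fun x₀ => ?_)
  simp only
  rw [← gaussDensity_smul d hf (sq_nonneg g), smul_sub, smul_inv_smul₀ hf.ne']
end

section
/- Let β : ℝ → ℝ be continuous and define B(t) := ∫_0^t β(s) ds. Then the function v(t) := ( e^{B(t)} − 1 )² satisfies v(0) = 0 and, for every t, v′(t) = β(t) v(t) + β(t) ( e^{2 B(t)} − 1 ). -/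
/-- The perturbation-kernel variance of the contractive subVP SDE: with
`B(t) = ∫_0^t β(s) ds`, the function `v(t) = (e^{B(t)} − 1)²` satisfies `v(0) = 0`
and the linear ODE `v′(t) = β(t) v(t) + β(t)(e^{2B(t)} − 1)`. -/
theorem csubvp_variance_ode (β : ℝ → ℝ) (hβ : Continuous β)
    (B : ℝ → ℝ) (hB : ∀ t, B t = ∫ s in (0 : ℝ)..t, β s)
    (v : ℝ → ℝ) (hv : ∀ t, v t = (Real.exp (B t) - 1) ^ 2) :
    v 0 = 0 ∧
    ∀ t : ℝ, HasDerivAt v (β t * v t + β t * (Real.exp (2 * B t) - 1)) t := by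
  obtain rfl : B = fun t => ∫ s in (0 : ℝ)..t, β s := funext hB
  obtain rfl := funext hv
  refine ⟨by simp, fun t => ?_⟩
  have hderiv := (((hβ.integral_hasStrictDerivAt 0 t).hasDerivAt.exp).sub_const 1).pow 2
  refine hderiv.congr_deriv ?_
  rw [two_mul (∫ s in (0 : ℝ)..t, β s), Real.exp_add]
  push_cast
  ring
end

section
/- Let T > 0, let 0 < β_min ≤ β_max, define β(s) := β_min + (s/T)(β_max − β_min) for s ∈ [0,T] and B(s) := ∫_0^s β(v) dv. Let κ > 0, 0 < h < 1/2, and define u(t) := ∫_{T−t}^{T} β(s)( −1 + 2h − 2κ/((1+κ) e^{B(s)} − κ) ) ds for t ∈ [0,T]. Let M ≥ 0, ε ≥ 0 and η ≥ 0 satisfy η² ≤ e^{B(T)} M. Then η² e^{u(T)} + (ε²/(2h)) ∫_0^T β(t) e^{u(T) − u(T−t)} dt ≤ exp( −2( (κ/(1+κ))(1 − e^{−β_min T}) − β_max h T ) ) · M + ε² / ( 2h(1−2h) ). -/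
open intervalIntegral Set in
/-- If `B` is an antiderivative of `β`, then `∫ β e^{-cB}` is explicit. -/
theorem integral_mul_exp_neg_mul {β B : ℝ → ℝ} (hβ : Continuous β)
    (hB : ∀ s, HasDerivAt B (β s) s) {c : ℝ} (hc : c ≠ 0) (a b : ℝ) :
    ∫ s in a..b, β s * Real.exp (-c * B s)
      = (Real.exp (-c * B a) - Real.exp (-c * B b)) / c := by
  have hBc : Continuous B := continuous_iff_continuousAt.2 fun s => (hB s).continuousAt
  have hderiv : ∀ s ∈ uIcc a b, HasDerivAt (fun s => -(Real.exp (-c * B s) / c))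
      (β s * Real.exp (-c * B s)) s := fun s _ => by
    refine ((((hB s).const_mul (-c)).exp).div_const c).fun_neg.congr_deriv ?_
    field_simp
  rw [integral_eq_sub_of_hasDerivAt hderiv (Continuous.intervalIntegrable (by fun_prop) _ _)]
  ring

/-- For `x ≥ 0`, the denominator `(1 + κ) e^x - κ` is positive. -/
theorem one_add_mul_exp_sub_pos {κ x : ℝ} (hκ : 0 ≤ κ) (hx : 0 ≤ x) :
    0 < (1 + κ) * Real.exp x - κ := by
  nlinarith [Real.one_le_exp hx]

/-- The strong concavity modulus is at least its exponential lower bound. -/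
theorem mul_exp_neg_le_div_one_add_mul_exp_sub {κ x : ℝ} (hκ : 0 ≤ κ) (hx : 0 ≤ x) :
    2 * (κ / (1 + κ)) * Real.exp (-1 * x) ≤ 2 * κ / ((1 + κ) * Real.exp x - κ) := by
  have hpos := one_add_mul_exp_sub_pos hκ hx
  calc 2 * (κ / (1 + κ)) * Real.exp (-1 * x) = 2 * κ / ((1 + κ) * Real.exp x) := by
        rw [neg_one_mul, Real.exp_neg]
        field_simp
    _ ≤ 2 * κ / ((1 + κ) * Real.exp x - κ) := by
        gcongr
        linarith


/-- Analytic core of the Wasserstein-2 bound for the contractive VP diffusion model: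
with the linear schedule `β(s) = β_min + (s/T)(β_max − β_min)`, `B(s) = ∫_0^s β`,
Grönwall exponent `u(t) = ∫_{T−t}^T β(s)(−1 + 2h − 2κ/((1+κ)e^{B(s)} − κ)) ds`, and
`η² ≤ e^{B(T)} M`, one has
`η² e^{u(T)} + (ε²/(2h)) ∫_0^T β(t) e^{u(T) − u(T−t)} dt
  ≤ exp(−2((κ/(1+κ))(1 − e^{−β_min T}) − β_max h T)) M + ε²/(2h(1−2h))`. -/
theorem cvp_wasserstein_core (T : ℝ) (hT : 0 < T)
    (βmin βmax : ℝ) (hβmin : 0 < βmin) (hββ : βmin ≤ βmax)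
    (β : ℝ → ℝ) (hβ : ∀ s, β s = βmin + (s / T) * (βmax - βmin))
    (B : ℝ → ℝ) (hB : ∀ s, B s = ∫ v in (0 : ℝ)..s, β v)
    (κ h : ℝ) (hκ : 0 < κ) (hh0 : 0 < h) (hh1 : h < 1 / 2)
    (u : ℝ → ℝ)
    (hu : ∀ t, u t = ∫ s in (T - t)..T,
        β s * (-1 + 2 * h - 2 * κ / ((1 + κ) * Real.exp (B s) - κ)))
    (M ε η : ℝ) (hM : 0 ≤ M) (hε : 0 ≤ ε) (hη : 0 ≤ η)
    (hηM : η ^ 2 ≤ Real.exp (B T) * M) :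
    η ^ 2 * Real.exp (u T)
      + (ε ^ 2 / (2 * h)) * ∫ t in (0 : ℝ)..T, β t * Real.exp (u T - u (T - t))
    ≤ Real.exp (-2 * ((κ / (1 + κ)) * (1 - Real.exp (-βmin * T)) - βmax * h * T)) * M
      + ε ^ 2 / (2 * h * (1 - 2 * h)) := by
  have hβc : Continuous β := by
    rw [funext hβ]
    fun_prop
  have hβ_ge : ∀ s ∈ Set.Icc 0 T, βmin ≤ β s := fun s hs => by
    rw [hβ]
    nlinarith [mul_nonneg (div_nonneg hs.1 hT.le) (sub_nonneg.2 hββ)]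
  have hβ_le : ∀ s ∈ Set.Icc 0 T, β s ≤ βmax := fun s hs => by
    rw [hβ]
    nlinarith [mul_nonneg (sub_nonneg.2 ((div_le_one hT).2 hs.2)) (sub_nonneg.2 hββ)]
  have hβ0 : ∀ s ∈ Set.Icc 0 T, 0 ≤ β s := fun s hs => hβmin.le.trans (hβ_ge s hs)
  have hBd : ∀ s, HasDerivAt B (β s) s := fun s => by
    rw [funext hB]
    exact hβc.integral_hasStrictDerivAt 0 s |>.hasDerivAt
  have hBc : Continuous B := continuous_iff_continuousAt.2 fun s => (hBd s).continuousAt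
  have hBzero : B 0 = 0 := by simp [hB]
  have hB0 : ∀ s ∈ Set.Icc 0 T, 0 ≤ B s := fun s hs => by
    rw [hB]
    exact intervalIntegral.integral_nonneg hs.1 fun v hv => hβ0 v ⟨hv.1, hv.2.trans hs.2⟩
  have hB_ge : βmin * T ≤ B T := by
    have := intervalIntegral.integral_mono_on (μ := MeasureTheory.volume) hT.le
      (continuous_const.intervalIntegrable 0 T) (hβc.intervalIntegrable 0 T) hβ_ge
    rw [intervalIntegral.integral_const, ← hB] at this
    simpa [mul_comm] using this
  have hB_le : B T ≤ βmax * T := by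
    have := intervalIntegral.integral_mono_on (μ := MeasureTheory.volume) hT.le
      (hβc.intervalIntegrable 0 T) (continuous_const.intervalIntegrable 0 T) hβ_le
    rw [intervalIntegral.integral_const, ← hB] at this
    simpa [mul_comm] using this
  set g : ℝ → ℝ := fun s =>
    β s * (-1 + 2 * h - 2 * κ / ((1 + κ) * Real.exp (B s) - κ)) with hg
  have hgc : ContinuousOn g (Set.Icc 0 T) := by
    refine hβc.continuousOn.mul (continuousOn_const.sub (continuousOn_const.div ?_ ?_))
    · fun_prop
    · exact fun s hs => (one_add_mul_exp_sub_pos hκ.le (hB0 s hs)).ne'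
  have hgi : ∀ a ∈ Set.Icc 0 T, ∀ b ∈ Set.Icc 0 T,
      IntervalIntegrable g MeasureTheory.volume a b := fun a ha b hb =>
    (hgc.mono (Set.uIcc_subset_Icc ha hb)).intervalIntegrable
  have h0 : (0 : ℝ) ∈ Set.Icc 0 T := ⟨le_rfl, hT.le⟩
  have hT' : T ∈ Set.Icc 0 T := ⟨hT.le, le_rfl⟩
  have hg_le : ∀ s ∈ Set.Icc 0 T,
      g s ≤ -(1 - 2 * h) * β s - 2 * (κ / (1 + κ)) * (β s * Real.exp (-1 * B s)) := fun s hs => by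
    have := mul_le_mul_of_nonneg_left
      (mul_exp_neg_le_div_one_add_mul_exp_sub hκ.le (hB0 s hs)) (hβ0 s hs)
    simp only [hg]
    linarith
  have hG_le : ∀ t ∈ Set.Icc 0 T, ∫ s in (0 : ℝ)..t, g s
      ≤ -(1 - 2 * h) * B t - 2 * (κ / (1 + κ)) * (1 - Real.exp (-B t)) := fun t ht => by
    have hi₁ : IntervalIntegrable (fun s => -(1 - 2 * h) * β s) MeasureTheory.volume 0 t :=
      Continuous.intervalIntegrable (by fun_prop) _ _
    have hi₂ : IntervalIntegrable (fun s => 2 * (κ / (1 + κ)) * (β s * Real.exp (-1 * B s)))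
        MeasureTheory.volume 0 t := Continuous.intervalIntegrable (by fun_prop) _ _
    refine (intervalIntegral.integral_mono_on ht.1 (hgi 0 h0 t ht) (hi₁.sub hi₂)
      fun s hs => hg_le s ⟨hs.1, hs.2.trans ht.2⟩).trans_eq ?_
    rw [intervalIntegral.integral_sub hi₁ hi₂, intervalIntegral.integral_const_mul,
      intervalIntegral.integral_const_mul, integral_mul_exp_neg_mul hβc hBd one_ne_zero, ← hB,
      hBzero]
    simp
  have huT : u T = ∫ s in (0 : ℝ)..T, g s := by rw [hu, sub_self]
  have hu_sub : ∀ t ∈ Set.Icc 0 T, u T - u (T - t) = ∫ s in (0 : ℝ)..t, g s := fun t ht => by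
    rw [huT, hu, sub_sub_cancel, sub_eq_iff_eq_add,
      intervalIntegral.integral_add_adjacent_intervals (hgi 0 h0 t ht) (hgi t ht T hT')]
  have hinit : η ^ 2 * Real.exp (u T)
      ≤ Real.exp (-2 * ((κ / (1 + κ)) * (1 - Real.exp (-βmin * T)) - βmax * h * T)) * M := by
    have hexponent : B T + u T
        ≤ -2 * ((κ / (1 + κ)) * (1 - Real.exp (-βmin * T)) - βmax * h * T) := by
      have hexp : Real.exp (-B T) ≤ Real.exp (-βmin * T) := Real.exp_le_exp.2 (by linarith)
      have h₁ := mul_le_mul_of_nonneg_left hexp (show 0 ≤ κ / (1 + κ) by positivity)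
      have h₂ := mul_le_mul_of_nonneg_left hB_le hh0.le
      have h₃ := hG_le T hT'
      rw [← huT] at h₃
      linarith
    calc η ^ 2 * Real.exp (u T) ≤ Real.exp (B T) * M * Real.exp (u T) := by gcongr
      _ = Real.exp (B T + u T) * M := by rw [Real.exp_add]; ring
      _ ≤ _ := by gcongr
  have hc : 0 < 1 - 2 * h := by linarith
  have hscore : ∫ t in (0 : ℝ)..T, β t * Real.exp (u T - u (T - t)) ≤ 1 / (1 - 2 * h) := by
    have hcont : ContinuousOn (fun t => β t * Real.exp (u T - u (T - t))) (Set.Icc 0 T) := by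
      have hGc : ContinuousOn (fun t => ∫ s in (0 : ℝ)..t, g s) (Set.Icc 0 T) := by
        have := intervalIntegral.continuousOn_primitive_interval
          (μ := MeasureTheory.volume) (f := g) (a := 0) (b := T)
          (by rw [Set.uIcc_of_le hT.le]; exact hgc.integrableOn_Icc)
        rwa [Set.uIcc_of_le hT.le] at this
      exact hβc.continuousOn.mul (hGc.congr hu_sub).rexp
    calc ∫ t in (0 : ℝ)..T, β t * Real.exp (u T - u (T - t))
        ≤ ∫ t in (0 : ℝ)..T, β t * Real.exp (-(1 - 2 * h) * B t) := by
          refine intervalIntegral.integral_mono_on hT.le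
            (hcont.intervalIntegrable_of_Icc hT.le)
            (Continuous.intervalIntegrable (by fun_prop) _ _) fun t ht => ?_
          refine mul_le_mul_of_nonneg_left (Real.exp_le_exp.2 ?_) (hβ0 t ht)
          rw [hu_sub t ht]
          have hexp : Real.exp (-B t) ≤ 1 := Real.exp_le_one_iff.2 (neg_nonpos.2 (hB0 t ht))
          have := mul_nonneg (show 0 ≤ 2 * (κ / (1 + κ)) by positivity) (sub_nonneg.2 hexp)
          linarith [hG_le t ht]
      _ ≤ 1 / (1 - 2 * h) := by
          rw [integral_mul_exp_neg_mul hβc hBd hc.ne', hBzero, mul_zero, Real.exp_zero]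
          gcongr
          linarith [Real.exp_pos (-(1 - 2 * h) * B T)]
  refine add_le_add hinit ?_
  calc ε ^ 2 / (2 * h) * ∫ t in (0 : ℝ)..T, β t * Real.exp (u T - u (T - t))
      ≤ ε ^ 2 / (2 * h) * (1 / (1 - 2 * h)) := by gcongr
    _ = ε ^ 2 / (2 * h * (1 - 2 * h)) := by rw [div_mul_div_comm, mul_one]
end
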